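/- arXiv:math/0407057 — 2 statements merged into one kernel-verified Lean document; each statement's English description precedes it below -/
import Mathlib

section
/- For every R ∈ (0,∞) and every ε > 0 there exists a finite constant T_{R,ε} such that for every fluid model solution n(·) with ‖n(0)‖ ≤ R, one has d(M_α, n(t)) < ε for all t > T_{R,ε}, where d(M_α, n) = inf{‖v − n‖ : v ∈ M_α} is the Euclidean distance from n to the set of invariant states M_α. -/
open Real Set

noncomputable section

/-- Feasible set for the bandwidth allocation problem at state `n`: the vector
`Λ⁺ = (Λ_i : i ∈ I₊(n))` is embedded in `ℝ^I` by requiring `L i = 0` whenever `n i = 0`. -/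
def Feasible {I J : ℕ} (A : Fin J → Fin I → ℝ) (C : Fin J → ℝ)
    (n : Fin I → ℝ) : Set (Fin I → ℝ) :=
  {L | (∀ i, 0 ≤ L i) ∧ (∀ i, n i = 0 → L i = 0) ∧ ∀ j, ∑ i, A j i * L i ≤ C j}

/-- The objective `G_n(Λ⁺)`, taking the value `⊥ = -∞` when `α ≥ 1` and some
coordinate of `Λ⁺` in `I₊(n)` vanishes. -/
def Gfun {I : ℕ} (α : ℝ) (κ : Fin I → ℝ) (n L : Fin I → ℝ) : EReal :=
  if 1 ≤ α ∧ ∃ i, 0 < n i ∧ L i = 0 then ⊥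
  else if α = 1 then
    ((∑ i, if 0 < n i then κ i * n i * Real.log (L i) else 0 : ℝ) : EReal)
  else
    ((∑ i, if 0 < n i then κ i * n i ^ α * L i ^ (1 - α) / (1 - α) else 0 : ℝ) : EReal)

/-- `L` is an optimal weighted α-fair bandwidth allocation for the state `n`,
i.e. a maximizer of `G_n` over the feasible set for `n` (with `L i = 0` for `i ∈ I₀(n)`). -/
def IsAlloc {I J : ℕ} (A : Fin J → Fin I → ℝ) (C : Fin J → ℝ) (α : ℝ)
    (κ : Fin I → ℝ) (n L : Fin I → ℝ) : Prop :=
  L ∈ Feasible A C n ∧ ∀ L' ∈ Feasible A C n, Gfun α κ n L' ≤ Gfun α κ n L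

/-- `f` is absolutely continuous on `[0, T]` for every `T > 0` (ε-δ definition with
finitely many pairwise disjoint subintervals). -/
def AbsContNonneg (f : ℝ → ℝ) : Prop :=
  ∀ T > (0:ℝ), ∀ ε > (0:ℝ), ∃ δ > (0:ℝ), ∀ (m : ℕ) (a b : Fin m → ℝ),
    (∀ k, 0 ≤ a k ∧ a k ≤ b k ∧ b k ≤ T) →
    (∀ k l, k < l → b k ≤ a l ∨ b l ≤ a k) →
    (∑ k, (b k - a k)) < δ → (∑ k, |f (b k) - f (a k)|) < ε

/-- Fluid model solution: `n : [0,∞) → ℝ₊^I` absolutely continuous, and at every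
regular point `t` the derivative conditions (13) and capacity condition (14) hold. -/
def IsFluidSol {I J : ℕ} (A : Fin J → Fin I → ℝ) (C : Fin J → ℝ)
    (ν μ : Fin I → ℝ) (Λ : (Fin I → ℝ) → Fin I → ℝ)
    (n : ℝ → Fin I → ℝ) : Prop :=
  (∀ i, AbsContNonneg fun t => n t i) ∧
  (∀ t ∈ Ici (0:ℝ), ∀ i, 0 ≤ n t i) ∧
  ∀ t ∈ Ici (0:ℝ),
    (∀ i, DifferentiableWithinAt ℝ (fun s => n s i) (Ici 0) t) →
    (∀ i, (0 < n t i →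
        HasDerivWithinAt (fun s => n s i) (ν i - μ i * Λ (n t) i) (Ici 0) t) ∧
      (n t i = 0 → HasDerivWithinAt (fun s => n s i) 0 (Ici 0) t)) ∧
    ∀ j, (∑ i, A j i * (if 0 < n t i then Λ (n t) i else ν i / μ i)) ≤ C j

/-- The set `J*` of critically loaded resources. -/
def Jstar {I J : ℕ} (A : Fin J → Fin I → ℝ) (C : Fin J → ℝ)
    (ν μ : Fin I → ℝ) : Set (Fin J) :=
  {j | ∑ i, A j i * (ν i / μ i) = C j}

/-- The workload map `w(n)`. -/
def wl {I J : ℕ} (A : Fin J → Fin I → ℝ) (μ : Fin I → ℝ)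
    (n : Fin I → ℝ) : Fin J → ℝ :=
  fun j => ∑ i, A j i * n i / μ i

/-- Feasible set of the workload optimization problem (22) for workload `w`. -/
def WFeasible {I J : ℕ} (A : Fin J → Fin I → ℝ) (C : Fin J → ℝ)
    (ν μ : Fin I → ℝ) (w : Fin J → ℝ) : Set (Fin I → ℝ) :=
  {m | (∀ i, 0 ≤ m i) ∧ ∀ j ∈ Jstar A C ν μ, w j ≤ ∑ i, A j i * m i / μ i}

/-- The Lyapunov function `F`. -/
def Ffun {I : ℕ} (α : ℝ) (κ ν μ : Fin I → ℝ) (n : Fin I → ℝ) : ℝ :=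
  (1 / (α + 1)) * ∑ i, ν i * κ i * μ i ^ (α - 1) * (n i / ν i) ^ (α + 1)

/-- The function `K` (the derivative of `F` along fluid model solutions). -/
def Kfun {I : ℕ} (α : ℝ) (κ ν μ : Fin I → ℝ)
    (Λ : (Fin I → ℝ) → Fin I → ℝ) (n : Fin I → ℝ) : ℝ :=
  ∑ i, if 0 < n i then κ i * (μ i * n i / ν i) ^ α * (ν i / μ i - Λ n i) else 0

section aux
open Filter Topology MeasureTheory

theorem aux_ac {f : ℝ → ℝ} (hf : AbsContNonneg f) {T : ℝ} (hT : 0 < T) :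
    AbsolutelyContinuousOnInterval f 0 T := by
  rw [absolutelyContinuousOnInterval_iff]
  intro ε hε
  obtain ⟨δ, hδ, H⟩ := hf T hT ε hε
  refine ⟨δ, hδ, ?_⟩
  rintro ⟨m, E⟩ ⟨hE1, hE2⟩ hlen
  simp only [Finset.mem_range, uIcc_of_le hT.le, mem_Icc] at hE1
  simp only at hlen ⊢
  have key := H m (fun k => if (E k).1 = (E k).2 then 0 else min (E k).1 (E k).2)
    (fun k => if (E k).1 = (E k).2 then 0 else max (E k).1 (E k).2) ?_ ?_ ?_
  · rw [Finset.sum_range]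
    refine lt_of_le_of_lt (le_of_eq ?_) key
    refine Finset.sum_congr rfl fun k _ => ?_
    by_cases h : (E k).1 = (E k).2
    · simp [h]
    · simp only [h, if_false, Real.dist_eq]
      rcases le_total (E k).1 (E k).2 with h' | h'
      · rw [max_eq_right h', min_eq_left h', abs_sub_comm]
      · rw [max_eq_left h', min_eq_right h']
  · intro k
    have := hE1 k k.2
    by_cases h : (E k).1 = (E k).2
    · simp [h, hT.le]
    · simp only [h, if_false]
      refine ⟨le_min this.1.1 this.2.1, min_le_max, max_le this.1.2 this.2.2⟩
  · intro k l hkl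
    have h1 := hE1 k k.2
    have h2 := hE1 l l.2
    by_cases h : (E k).1 = (E k).2
    · left
      simp only [h, if_true]
      split_ifs
      · exact le_rfl
      · exact le_min h2.1.1 h2.2.1
    by_cases h' : (E l).1 = (E l).2
    · right
      simp only [h', if_true]
      split_ifs
      exact le_min h1.1.1 h1.2.1
    simp only [h, h', if_false]
    have hne : (k : ℕ) ≠ l := by
      intro hh
      exact absurd (Fin.ext hh) hkl.ne
    have hd := hE2 (by simp) (by simp) hne
    simp only [Function.onFun, uIoc] at hd
    rw [Set.disjoint_left] at hd
    by_contra hcon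
    push Not at hcon
    have hk : min (E k).1 (E k).2 < max (E k).1 (E k).2 := by
      rcases lt_or_gt_of_ne h with h | h
      · exact lt_of_le_of_lt (min_le_left _ _) (lt_of_lt_of_le h (le_max_right _ _))
      · exact lt_of_le_of_lt (min_le_right _ _) (lt_of_lt_of_le h (le_max_left _ _))
    have hl : min (E l).1 (E l).2 < max (E l).1 (E l).2 := by
      rcases lt_or_gt_of_ne h' with h | h
      · exact lt_of_le_of_lt (min_le_left _ _) (lt_of_lt_of_le h (le_max_right _ _))
      · exact lt_of_le_of_lt (min_le_right _ _) (lt_of_lt_of_le h (le_max_left _ _))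
    have := @hd (min (max (E k).1 (E k).2) (max (E l).1 (E l).2))
      ⟨lt_min hk hcon.2, min_le_left _ _⟩
    exact this ⟨lt_min hcon.1 hl, min_le_right _ _⟩
  · rw [Finset.sum_range] at hlen
    refine lt_of_le_of_lt (le_of_eq ?_) hlen
    refine Finset.sum_congr rfl fun k _ => ?_
    by_cases h : (E k).1 = (E k).2
    · simp [h]
    · simp only [h, if_false, Real.dist_eq, max_sub_min_eq_abs']

theorem aux_ac_comp {f : ℝ → ℝ} {a b : ℝ} (hf : AbsolutelyContinuousOnInterval f a b)
    {φ : ℝ → ℝ} (hφ : ContDiff ℝ 1 φ) :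
    AbsolutelyContinuousOnInterval (fun t => φ (f t)) a b := by
  obtain ⟨M, hM⟩ := hf.exists_bound
  obtain ⟨K, hK⟩ := (hφ.contDiffOn (s := Icc (-M) M)).exists_lipschitzOnWith (by decide)
    (convex_Icc _ _) isCompact_Icc
  rw [absolutelyContinuousOnInterval_iff] at hf ⊢
  intro ε hε
  obtain ⟨δ, hδ, H⟩ := hf (ε / (K + 1)) (by positivity)
  refine ⟨δ, hδ, fun E hE hlen => ?_⟩
  have h1 := H E hE hlen
  have h2 : ∑ i ∈ Finset.range E.1, dist (φ (f (E.2 i).1)) (φ (f (E.2 i).2)) ≤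
      ∑ i ∈ Finset.range E.1, K * dist (f (E.2 i).1) (f (E.2 i).2) := by
    refine Finset.sum_le_sum fun i hi => ?_
    have := hE.1 i hi
    exact hK.dist_le_mul _ (abs_le.1 (hM _ this.1)) _ (abs_le.1 (hM _ this.2))
  rw [← Finset.mul_sum] at h2
  have h3 : (0:ℝ) ≤ ∑ i ∈ Finset.range E.1, dist (f (E.2 i).1) (f (E.2 i).2) :=
    Finset.sum_nonneg fun _ _ => dist_nonneg
  rw [lt_div_iff₀ (by positivity)] at h1
  nlinarith

theorem aux_ac_sum {ι : Type*} (s : Finset ι) {f : ι → ℝ → ℝ} {a b : ℝ}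
    (hf : ∀ i ∈ s, AbsolutelyContinuousOnInterval (f i) a b) :
    AbsolutelyContinuousOnInterval (fun t => ∑ i ∈ s, f i t) a b := by
  classical
  induction s using Finset.induction_on with
  | empty =>
    simp only [Finset.sum_empty]
    exact (contDiff_const (n := 1)).contDiffOn.absolutelyContinuousOnInterval
  | insert i s hi ih =>
    simp only [Finset.sum_insert hi]
    exact (hf i (by simp)).fun_add (ih fun j hj => hf j (by simp [hj]))

theorem aux_ac_drop {f : ℝ → ℝ} {a b c : ℝ} (hab : a ≤ b)
    (hf : AbsolutelyContinuousOnInterval f a b)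
    (h : ∀ᵐ x, x ∈ Icc a b → ∃ f', HasDerivAt f f' x ∧ f' ≤ c) :
    f b - f a ≤ c * (b - a) := by
  rw [← hf.integral_deriv_eq_sub]
  have h1 : ∫ x in a..b, deriv f x ≤ ∫ x in a..b, c := by
    apply intervalIntegral.integral_mono_ae_restrict hab hf.intervalIntegrable_deriv (by simp)
    rw [EventuallyLE, ae_restrict_iff' measurableSet_Icc]
    filter_upwards [h] with x hx hx'
    obtain ⟨f', h1, h2⟩ := hx hx'
    rw [h1.deriv]; exact h2
  simp only [intervalIntegral.integral_const, smul_eq_mul] at h1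
  linarith

theorem aux_deriv_nonpos {h : ℝ → ℝ} {h' : ℝ} (hd : HasDerivAt h h' 0)
    (hle : ∀ᶠ s in 𝓝[>] (0:ℝ), h s ≤ h 0) : h' ≤ 0 := by
  have h1 := (hasDerivAt_iff_tendsto_slope.1 hd).mono_left
    (nhdsWithin_mono 0 (fun x (hx : x ∈ Ioi (0:ℝ)) => (ne_of_gt hx : x ≠ 0)))
  refine le_of_tendsto h1 ?_
  filter_upwards [hle, self_mem_nhdsWithin] with s hs hs'
  rw [slope_def_field]
  exact div_nonpos_of_nonpos_of_nonneg (by linarith) (by simpa using (le_of_lt hs'))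

/-- utility -/
def aux_u (α x : ℝ) : ℝ := if α = 1 then Real.log x else x ^ (1 - α) / (1 - α)

theorem aux_u_deriv {α x : ℝ} (hx : 0 < x) : HasDerivAt (aux_u α) (x ^ (-α)) x := by
  unfold aux_u
  by_cases h : α = 1
  · simp only [h, if_true]
    rw [Real.rpow_neg_one]
    exact Real.hasDerivAt_log hx.ne'
  · simp only [h, if_false]
    have h1 : 1 - α ≠ 0 := fun hh => h (by linarith)
    have := (Real.hasDerivAt_rpow_const (x := x) (p := 1 - α) (Or.inl hx.ne')).div_const (1 - α)
    rw [mul_div_cancel_left₀ _ h1, show 1 - α - 1 = -α by ring] at this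
    exact this

theorem aux_u_lt {α x r : ℝ} (hα : 0 < α) (hr : 0 < r) (hx : 0 ≤ x) (hx' : 1 ≤ α → 0 < x)
    (hne : x ≠ r) : aux_u α x - aux_u α r < r ^ (-α) * (x - r) := by
  have hyne : x / r ≠ 1 := by
    intro h; exact hne ((div_eq_one_iff_eq hr.ne').1 h)
  obtain ⟨y, rfl⟩ : ∃ y, x = y * r := ⟨x / r, by field_simp⟩
  rw [mul_div_cancel_right₀ _ hr.ne'] at hyne
  have hy : 0 ≤ y := nonneg_of_mul_nonneg_left hx hr
  have hy' : 1 ≤ α → 0 < y := fun h => pos_of_mul_pos_left (hx' h) hr.le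
  unfold aux_u
  by_cases h : α = 1
  · have hy0 := hy' h.ge
    simp only [h, if_true]
    rw [Real.log_mul hy0.ne' hr.ne', Real.rpow_neg_one]
    have := Real.log_lt_sub_one_of_pos hy0 hyne
    have h2 : r⁻¹ * (y * r - r) = y - 1 := by field_simp
    rw [h2]; linarith
  · simp only [h, if_false]
    have hp : 1 - α ≠ 0 := fun hh => h (by linarith)
    rw [Real.mul_rpow hy hr.le]
    have h2 : r ^ (-α) * (y * r - r) = r ^ (1 - α) * (y - 1) := by
      have : r ^ (1 - α) = r ^ (-α) * r := by
        rw [show 1 - α = -α + 1 by ring, Real.rpow_add_one hr.ne']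
      rw [this]; ring
    rw [h2]
    have h3 : y ^ (1 - α) * r ^ (1 - α) / (1 - α) - r ^ (1 - α) / (1 - α)
      = r ^ (1 - α) * ((y ^ (1 - α) - 1) / (1 - α)) := by ring
    rw [h3]
    refine mul_lt_mul_of_pos_left ?_ (Real.rpow_pos_of_pos hr _)
    rcases lt_or_gt_of_ne h with h1 | h1
    · rw [div_lt_iff₀ (by linarith)]
      have := rpow_one_add_lt_one_add_mul_self (s := y - 1) (by linarith)
        (sub_ne_zero.2 hyne) (p := 1 - α) (by linarith) (by linarith)
      rw [add_sub_cancel] at this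
      linarith
    · have hy0 := hy' h1.le
      rw [div_lt_iff_of_neg (by linarith)]
      have e1 := Real.log_lt_sub_one_of_pos hy0 hyne
      have e2 := Real.add_one_le_exp (Real.log y * (1 - α))
      rw [← Real.rpow_def_of_pos hy0] at e2
      nlinarith

theorem aux_u_le {α x r : ℝ} (hα : 0 < α) (hr : 0 < r) (hx : 0 ≤ x) (hx' : 1 ≤ α → 0 < x) :
    aux_u α x - aux_u α r ≤ r ^ (-α) * (x - r) := by
  by_cases h : x = r
  · simp [h]
  · exact (aux_u_lt hα hr hx hx' h).le

theorem aux_conv {α x y : ℝ} (hα : 0 < α) (hx : 0 ≤ x) (hy : 0 ≤ y) :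
    x ^ (α + 1) + (α + 1) * x ^ α * (y - x) ≤ y ^ (α + 1) := by
  rcases hx.eq_or_lt with rfl | hx
  · rw [Real.zero_rpow hα.ne', Real.zero_rpow (by linarith)]
    simpa using Real.rpow_nonneg hy _
  · obtain ⟨z, rfl⟩ : ∃ z, y = z * x := ⟨y / x, by field_simp⟩
    have hz : 0 ≤ z := nonneg_of_mul_nonneg_left hy hx
    rw [Real.mul_rpow hz hx.le, Real.rpow_add_one hx.ne']
    have := one_add_mul_self_le_rpow_one_add (s := z - 1) (by linarith) (p := α + 1) (by linarith)
    rw [add_sub_cancel] at this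
    have h2 : 0 < x ^ α * x := by positivity
    nlinarith

theorem aux_Gfun {I : ℕ} {α : ℝ} (hα : 0 < α) {κ n L : Fin I → ℝ} (hn : ∀ i, 0 ≤ n i)
    (hL : 1 ≤ α → ∀ i, 0 < n i → L i ≠ 0) :
    Gfun α κ n L = ((∑ i, κ i * n i ^ α * aux_u α (L i) : ℝ) : EReal) := by
  unfold Gfun aux_u
  rw [if_neg]
  · split_ifs with h
    · congr 1
      refine Finset.sum_congr rfl fun i _ => ?_
      split_ifs with h'
      · rw [h, Real.rpow_one]
      · have : n i = 0 := le_antisymm (not_lt.1 h') (hn i)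
        simp [this, Real.zero_rpow hα.ne']
    · congr 1
      refine Finset.sum_congr rfl fun i _ => ?_
      split_ifs with h'
      · ring
      · have : n i = 0 := le_antisymm (not_lt.1 h') (hn i)
        simp [this, Real.zero_rpow hα.ne']
  · rintro ⟨h1, i, h2, h3⟩
    exact hL h1 i h2 h3

theorem aux_alloc {I J : ℕ} {A : Fin J → Fin I → ℝ} (hA : ∀ j i, 0 ≤ A j i)
    {C : Fin J → ℝ} {α : ℝ} (hα : 0 < α) {κ n Λ ρ : Fin I → ℝ} (hn : ∀ i, 0 ≤ n i)
    (hρ : ∀ i, 0 < ρ i) (hρC : ∀ j, ∑ i, A j i * ρ i ≤ C j)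
    (h : IsAlloc A C α κ n Λ) :
    (1 ≤ α → ∀ i, 0 < n i → 0 < Λ i) ∧
    ∀ L : Fin I → ℝ, (∀ i, 0 < L i) → (∀ j, ∑ i, A j i * L i ≤ C j) →
      ∑ i, κ i * n i ^ α * aux_u α (L i) ≤ ∑ i, κ i * n i ^ α * aux_u α (Λ i) := by
  obtain ⟨⟨hΛ0, -, -⟩, hopt⟩ := h
  have key : ∀ L : Fin I → ℝ, (∀ i, 0 < L i) → (∀ j, ∑ i, A j i * L i ≤ C j) →
      ((∑ i, κ i * n i ^ α * aux_u α (L i) : ℝ) : EReal) ≤ Gfun α κ n Λ := by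
    intro L hL hLC
    have h1 := hopt (fun i => if n i = 0 then 0 else L i) ⟨?_, ?_, ?_⟩
    · rw [aux_Gfun hα hn] at h1
      · refine le_trans (le_of_eq ?_) h1
        congr 1
        refine Finset.sum_congr rfl fun i _ => ?_
        by_cases hi : n i = 0
        · simp [hi, Real.zero_rpow hα.ne']
        · simp [hi]
      · intro _ i hi
        simp [hi.ne', (hL i).ne']
    · intro i
      dsimp only
      split_ifs
      · exact le_rfl
      · exact (hL i).le
    · intro i hi
      simp [hi]
    · intro j
      refine le_trans (Finset.sum_le_sum fun i _ => ?_) (hLC j)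
      refine mul_le_mul_of_nonneg_left ?_ (hA j i)
      dsimp only
      split_ifs
      · exact (hL i).le
      · exact le_rfl
  have hpos : 1 ≤ α → ∀ i, 0 < n i → 0 < Λ i := by
    intro h1 i hi
    refine lt_of_le_of_ne (hΛ0 i) fun h0 => ?_
    have h2 := key ρ hρ hρC
    unfold Gfun at h2
    rw [if_pos ⟨h1, i, hi, h0.symm⟩, le_bot_iff] at h2
    exact EReal.coe_ne_bot _ h2
  refine ⟨hpos, fun L hL hLC => ?_⟩
  have := key L hL hLC
  rw [aux_Gfun hα hn (fun h1 i hi => (hpos h1 i hi).ne')] at this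
  exact EReal.coe_le_coe_iff.1 this

/-- derivative of the Lyapunov function along solutions -/
def aux_K {I : ℕ} (α : ℝ) (κ ρ n Λ : Fin I → ℝ) : ℝ :=
  ∑ i, κ i * n i ^ α * (ρ i ^ (-α) * (ρ i - Λ i))

theorem aux_K_le {I J : ℕ} {A : Fin J → Fin I → ℝ} (hA : ∀ j i, 0 ≤ A j i)
    {C : Fin J → ℝ} {α : ℝ} (hα : 0 < α) {κ n Λ ρ : Fin I → ℝ} (hκ : ∀ i, 0 < κ i)
    (hn : ∀ i, 0 ≤ n i)
    (hρ : ∀ i, 0 < ρ i) (hρC : ∀ j, ∑ i, A j i * ρ i ≤ C j)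
    (h : IsAlloc A C α κ n Λ) (L : Fin I → ℝ) (hL : ∀ i, 0 < L i)
    (hLC : ∀ j, ∑ i, A j i * L i ≤ C j) :
    aux_K α κ ρ n Λ ≤ ∑ i, κ i * n i ^ α * (aux_u α (ρ i) - aux_u α (L i)) := by
  obtain ⟨h1, h2⟩ := aux_alloc hA hα hn hρ hρC h
  have h3 : aux_K α κ ρ n Λ ≤ ∑ i, κ i * n i ^ α * (aux_u α (ρ i) - aux_u α (Λ i)) := by
    unfold aux_K
    refine Finset.sum_le_sum fun i _ => ?_
    rcases (hn i).eq_or_lt with h0 | h0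
    · simp [← h0, Real.zero_rpow hα.ne']
    · refine mul_le_mul_of_nonneg_left ?_
        (mul_nonneg (hκ i).le (Real.rpow_nonneg (hn i) _))
      have := aux_u_le hα (hρ i) (h.1.1 i) (fun h' => h1 h' i h0)
      linarith
  have h4 := h2 L hL hLC
  simp only [mul_sub, Finset.sum_sub_distrib] at h3 ⊢
  linarith

theorem aux_K_eq {I J : ℕ} {A : Fin J → Fin I → ℝ} (hA : ∀ j i, 0 ≤ A j i)
    {C : Fin J → ℝ} {α : ℝ} (hα : 0 < α) {κ n Λ ρ : Fin I → ℝ} (hκ : ∀ i, 0 < κ i)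
    (hn : ∀ i, 0 ≤ n i)
    (hρ : ∀ i, 0 < ρ i) (hρC : ∀ j, ∑ i, A j i * ρ i ≤ C j)
    (h : IsAlloc A C α κ n Λ) (hK : 0 ≤ aux_K α κ ρ n Λ) :
    ∀ i, 0 < n i → Λ i = ρ i := by
  obtain ⟨h1, h2⟩ := aux_alloc hA hα hn hρ hρC h
  by_contra hcon
  push Not at hcon
  obtain ⟨k, hk, hne⟩ := hcon
  have h3 : aux_K α κ ρ n Λ < ∑ i, κ i * n i ^ α * (aux_u α (ρ i) - aux_u α (Λ i)) := by
    unfold aux_K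
    refine Finset.sum_lt_sum (fun i _ => ?_) ⟨k, Finset.mem_univ _, ?_⟩
    · rcases (hn i).eq_or_lt with h0 | h0
      · simp [← h0, Real.zero_rpow hα.ne']
      · refine mul_le_mul_of_nonneg_left ?_
          (mul_nonneg (hκ i).le (Real.rpow_nonneg (hn i) _))
        have := aux_u_le hα (hρ i) (h.1.1 i) (fun h' => h1 h' i h0)
        linarith
    · refine mul_lt_mul_of_pos_left ?_ (mul_pos (hκ k) (Real.rpow_pos_of_pos hk _))
      have := aux_u_lt hα (hρ k) (h.1.1 k) (fun h' => h1 h' k hk) hne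
      linarith
  have h4 := h2 ρ hρ hρC
  simp only [mul_sub, Finset.sum_sub_distrib] at h3
  linarith

/-- Lyapunov function -/
def aux_F {I : ℕ} (α : ℝ) (d n : Fin I → ℝ) : ℝ :=
  ∑ i, d i / (α + 1) * n i ^ (α + 1)

theorem aux_F_cont {I : ℕ} {α : ℝ} (hα : 0 < α) (d : Fin I → ℝ) :
    Continuous (aux_F α d) := by
  unfold aux_F
  refine continuous_finsetSum _ fun i _ => ?_
  exact continuous_const.mul ((continuous_apply i).rpow_const fun _ => Or.inr (by linarith))

theorem aux_F_deriv {I : ℕ} {α : ℝ} (hα : 0 < α) (d : Fin I → ℝ) {n : ℝ → Fin I → ℝ}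
    {n' : Fin I → ℝ} {t : ℝ} (h : ∀ i, HasDerivAt (fun s => n s i) (n' i) t) :
    HasDerivAt (fun s => aux_F α d (n s)) (∑ i, d i * n t i ^ α * n' i) t := by
  unfold aux_F
  refine HasDerivAt.fun_sum fun i _ => ?_
  have h1 := ((h i).rpow_const (p := α + 1) (Or.inr (by linarith))).const_mul (d i / (α + 1))
  convert! h1 using 1
  rw [add_sub_cancel_right]
  have : α + 1 ≠ 0 := by linarith
  field_simp

theorem aux_F_convex {I : ℕ} {α : ℝ} (hα : 0 < α) {d n m : Fin I → ℝ} (hd : ∀ i, 0 < d i)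
    (hn : ∀ i, 0 ≤ n i) (hm : ∀ i, 0 ≤ m i) :
    aux_F α d n + ∑ i, d i * n i ^ α * (m i - n i) ≤ aux_F α d m := by
  unfold aux_F
  rw [← Finset.sum_add_distrib]
  refine Finset.sum_le_sum fun i _ => ?_
  have h1 := aux_conv hα (hn i) (hm i)
  have h2 : 0 < d i / (α + 1) := div_pos (hd i) (by linarith)
  have h3 := mul_le_mul_of_nonneg_left h1 h2.le
  refine le_trans (le_of_eq ?_) h3
  have : α + 1 ≠ 0 := by linarith
  field_simp

/-- workload domination -/
def aux_W {I J : ℕ} (A : Fin J → Fin I → ℝ) (C : Fin J → ℝ) (ρ μ n m : Fin I → ℝ) : Prop :=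
  (∀ i, 0 ≤ m i) ∧ ∀ j, ∑ i, A j i * ρ i = C j → ∑ i, A j i * (n i / μ i) ≤ ∑ i, A j i * (m i / μ i)

theorem aux_var {I J : ℕ} {A : Fin J → Fin I → ℝ}
    {C : Fin J → ℝ} {α : ℝ} (hα : 0 < α) {κ n m ρ μ d : Fin I → ℝ} (hκ : ∀ i, 0 < κ i)
    (hμ : ∀ i, 0 < μ i) (hn : ∀ i, 0 ≤ n i)
    (hρ : ∀ i, 0 < ρ i) (hρC : ∀ j, ∑ i, A j i * ρ i ≤ C j)
    (hd : ∀ i, d i = κ i * ρ i ^ (-α) / μ i)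
    (hW : aux_W A C ρ μ n m)
    (H : ∀ L : Fin I → ℝ, (∀ i, 0 < L i) → (∀ j, ∑ i, A j i * L i ≤ C j) →
      0 ≤ ∑ i, κ i * n i ^ α * (aux_u α (ρ i) - aux_u α (L i))) :
    aux_F α d n ≤ aux_F α d m := by
  set x : Fin I → ℝ := fun i => (m i - n i) / μ i with hx
  have hd0 : ∀ i, 0 < d i := fun i => by
    rw [hd]; exact div_pos (mul_pos (hκ i) (Real.rpow_pos_of_pos (hρ i) _)) (hμ i)
  have hder : HasDerivAt (fun s : ℝ => ∑ i, κ i * n i ^ α * aux_u α (ρ i - s * x i))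
      (∑ i, κ i * n i ^ α * (ρ i ^ (-α) * (-x i))) 0 := by
    refine HasDerivAt.fun_sum fun i _ => ?_
    refine HasDerivAt.const_mul _ ?_
    have h1 : HasDerivAt (fun s : ℝ => ρ i - s * x i) (-x i) 0 := by
      have := ((hasDerivAt_id (0:ℝ)).mul_const (x i)).const_sub (ρ i)
      simpa using this
    have h2 : HasDerivAt (aux_u α) (ρ i ^ (-α)) (ρ i - 0 * x i) := by
      simpa using aux_u_deriv (hρ i)
    exact h2.comp (0:ℝ) h1
  have hle := aux_deriv_nonpos hder ?_
  · have hc := aux_F_convex hα hd0 hn hW.1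
    have : ∑ i, d i * n i ^ α * (m i - n i) = - ∑ i, κ i * n i ^ α * (ρ i ^ (-α) * (-x i)) := by
      rw [← Finset.sum_neg_distrib]
      refine Finset.sum_congr rfl fun i _ => ?_
      rw [hd, hx]
      have := (hμ i).ne'
      field_simp
    linarith
  · have e1 : ∀ i, ∀ᶠ s in 𝓝[>] (0:ℝ), 0 < ρ i - s * x i := fun i => by
      have : Tendsto (fun s : ℝ => ρ i - s * x i) (𝓝[>] (0:ℝ)) (𝓝 (ρ i - 0 * x i)) :=
        (Continuous.tendsto (by fun_prop) 0).mono_left nhdsWithin_le_nhds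
      refine this.eventually_const_lt ?_
      simpa using hρ i
    have e2 : ∀ j, ∀ᶠ s in 𝓝[>] (0:ℝ), ∑ i, A j i * (ρ i - s * x i) ≤ C j := fun j => by
      rcases (hρC j).eq_or_lt with hj | hj
      · filter_upwards [self_mem_nhdsWithin] with s hs
        have hs : 0 < s := hs
        have h1 := hW.2 j hj
        have h2 : ∑ i, A j i * (ρ i - s * x i) =
            C j - s * (∑ i, A j i * (m i / μ i) - ∑ i, A j i * (n i / μ i)) := by
          rw [← hj, ← Finset.sum_sub_distrib, Finset.mul_sum, ← Finset.sum_sub_distrib]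
          refine Finset.sum_congr rfl fun i _ => ?_
          rw [hx]; ring
        rw [h2]
        nlinarith
      · have : Tendsto (fun s : ℝ => ∑ i, A j i * (ρ i - s * x i)) (𝓝[>] (0:ℝ))
            (𝓝 (∑ i, A j i * (ρ i - 0 * x i))) :=
          (Continuous.tendsto (f := fun s : ℝ => ∑ i, A j i * (ρ i - s * x i))
            (by fun_prop) 0).mono_left nhdsWithin_le_nhds
        refine (this.eventually_lt_const ?_).mono fun s hs => hs.le
        simpa using hj
    filter_upwards [eventually_all.2 e1, eventually_all.2 e2] with s h1 h2
    have := H _ h1 h2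
    simp only [mul_sub, Finset.sum_sub_distrib] at this
    simp only [zero_mul, sub_zero]
    linarith

theorem aux_inv {I J : ℕ} {A : Fin J → Fin I → ℝ}
    {C : Fin J → ℝ} {α : ℝ} (hα : 0 < α) {κ n ρ μ d Λ : Fin I → ℝ}
    (hμ : ∀ i, 0 < μ i) (hn : ∀ i, 0 ≤ n i)
    (hρ : ∀ i, 0 < ρ i)
    (hd : ∀ i, d i = κ i * ρ i ^ (-α) / μ i)
    (h : Λ ∈ Feasible A C n)
    (H : ∀ m, aux_W A C ρ μ n m → aux_F α d n ≤ aux_F α d m) :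
    0 ≤ aux_K α κ ρ n Λ := by
  have hder : HasDerivAt (fun s : ℝ => aux_F α d (fun i => n i + s * (μ i * (ρ i - Λ i))))
      (∑ i, d i * (n i + 0 * (μ i * (ρ i - Λ i))) ^ α * (μ i * (ρ i - Λ i))) 0 := by
    refine aux_F_deriv hα d (n := fun s i => n i + s * (μ i * (ρ i - Λ i))) fun i => ?_
    have := ((hasDerivAt_id (0:ℝ)).mul_const (μ i * (ρ i - Λ i))).const_add (n i)
    simpa using this
  have hle := aux_deriv_nonpos hder.neg ?_
  · have : ∑ i, d i * (n i + 0 * (μ i * (ρ i - Λ i))) ^ α * (μ i * (ρ i - Λ i))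
      = aux_K α κ ρ n Λ := by
      unfold aux_K
      refine Finset.sum_congr rfl fun i _ => ?_
      rw [hd, zero_mul, add_zero]
      have := (hμ i).ne'
      field_simp
    linarith
  · have e1 : ∀ i, ∀ᶠ s in 𝓝[>] (0:ℝ), 0 ≤ n i + s * (μ i * (ρ i - Λ i)) := fun i => by
      rcases (hn i).eq_or_lt with h0 | h0
      · filter_upwards [self_mem_nhdsWithin] with s hs
        have hs : 0 < s := hs
        rw [h.2.1 i h0.symm, ← h0, zero_add, sub_zero]
        have := hμ i
        have := hρ i
        positivity
      · have : Tendsto (fun s : ℝ => n i + s * (μ i * (ρ i - Λ i))) (𝓝[>] (0:ℝ))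
            (𝓝 (n i + 0 * (μ i * (ρ i - Λ i)))) :=
          (Continuous.tendsto (f := fun s : ℝ => n i + s * (μ i * (ρ i - Λ i)))
            (by fun_prop) 0).mono_left nhdsWithin_le_nhds
        refine (this.eventually_const_lt ?_).mono fun s hs => hs.le
        simpa using h0
    filter_upwards [eventually_all.2 e1, self_mem_nhdsWithin] with s h1 hs
    have hs : 0 < s := hs
    have := H (fun i => n i + s * (μ i * (ρ i - Λ i))) ⟨h1, fun j hj => ?_⟩
    · simp only [Pi.neg_apply, zero_mul, add_zero]
      linarith
    · have h2 : ∑ i, A j i * ((n i + s * (μ i * (ρ i - Λ i))) / μ i) =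
          ∑ i, A j i * (n i / μ i) + s * (∑ i, A j i * ρ i - ∑ i, A j i * Λ i) := by
        rw [← Finset.sum_sub_distrib, Finset.mul_sum, ← Finset.sum_add_distrib]
        refine Finset.sum_congr rfl fun i _ => ?_
        have := (hμ i).ne'
        field_simp
      rw [h2]
      have := h.2.2 j
      nlinarith

theorem aux_fluid_ac {I J : ℕ} {A : Fin J → Fin I → ℝ} {C : Fin J → ℝ}
    {ν μ : Fin I → ℝ} {Λ : (Fin I → ℝ) → Fin I → ℝ} {n : ℝ → Fin I → ℝ}
    (h : IsFluidSol A C ν μ Λ n) {a b : ℝ} (ha : 0 ≤ a) (hab : a ≤ b) (i : Fin I) :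
    AbsolutelyContinuousOnInterval (fun t => n t i) a b := by
  refine (aux_ac (h.1 i) (T := b + 1) (by linarith)).mono ?_
  rw [uIcc_of_le hab, uIcc_of_le (by linarith)]
  exact Icc_subset_Icc ha (by linarith)

theorem aux_fluid_ae {I J : ℕ} {A : Fin J → Fin I → ℝ} {C : Fin J → ℝ}
    {ν μ : Fin I → ℝ} {Λ : (Fin I → ℝ) → Fin I → ℝ} {n : ℝ → Fin I → ℝ}
    (h : IsFluidSol A C ν μ Λ n) {a b : ℝ} (ha : 0 ≤ a) (hab : a ≤ b) :
    ∀ᵐ t, t ∈ Icc a b →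
      (∀ i, HasDerivAt (fun s => n s i) (if 0 < n t i then ν i - μ i * Λ (n t) i else 0) t) ∧
      ∀ j, (∑ i, A j i * (if 0 < n t i then Λ (n t) i else ν i / μ i)) ≤ C j := by
  have h0 : ∀ᵐ t : ℝ, t ≠ 0 := by simp [ae_iff, measure_singleton]
  have h1 : ∀ᵐ t : ℝ, ∀ i, t ∈ uIcc a b → DifferentiableAt ℝ (fun s => n s i) t :=
    ae_all_iff.2 fun i => (aux_fluid_ac h ha hab i).ae_differentiableAt
  filter_upwards [h0, h1] with t ht0 ht1 ht
  rw [uIcc_of_le hab] at ht1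
  have htp : 0 < t := lt_of_le_of_ne (ha.trans ht.1) ht0.symm
  have hnh : Ici (0:ℝ) ∈ 𝓝 t := Ici_mem_nhds htp
  obtain ⟨e1, e2⟩ := h.2.2 t htp.le fun i => (ht1 i ht).differentiableWithinAt
  refine ⟨fun i => ?_, e2⟩
  split_ifs with hi
  · exact ((e1 i).1 hi).hasDerivAt hnh
  · exact ((e1 i).2 (le_antisymm (not_lt.1 hi) (h.2.1 t htp.le i))).hasDerivAt hnh

theorem aux_fluid_F {I J : ℕ} {A : Fin J → Fin I → ℝ} {C : Fin J → ℝ} {α : ℝ} (hα : 0 < α)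
    {ν μ κ ρ d : Fin I → ℝ} {Λ : (Fin I → ℝ) → Fin I → ℝ} {n : ℝ → Fin I → ℝ}
    (hμ : ∀ i, 0 < μ i) (hρ : ∀ i, ρ i = ν i / μ i)
    (hd : ∀ i, d i = κ i * ρ i ^ (-α) / μ i)
    (h : IsFluidSol A C ν μ Λ n) {a b c : ℝ} (ha : 0 ≤ a) (hab : a ≤ b)
    (hK : ∀ t ∈ Icc a b, aux_K α κ ρ (n t) (Λ (n t)) ≤ c) :
    aux_F α d (n b) - aux_F α d (n a) ≤ c * (b - a) := by
  refine aux_ac_drop (f := fun t => aux_F α d (n t)) hab ?_ ?_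
  · unfold aux_F
    refine aux_ac_sum _ fun i _ => ?_
    refine (aux_ac_comp (aux_fluid_ac h ha hab i) (φ := fun x => x ^ (α + 1)) ?_).const_mul _
    exact_mod_cast Real.contDiff_rpow_const_of_le (n := 1) (by simp; linarith)
  · filter_upwards [aux_fluid_ae h ha hab] with t ht htab
    refine ⟨_, aux_F_deriv hα d (ht htab).1, ?_⟩
    refine le_trans (le_of_eq ?_) (hK t htab)
    unfold aux_K
    refine Finset.sum_congr rfl fun i _ => ?_
    have hm := (hμ i).ne'
    split_ifs with hi
    · have e : ν i = ρ i * μ i := by rw [hρ]; field_simp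
      rw [hd, e]; field_simp
    · have : n t i = 0 := le_antisymm (not_lt.1 hi) (h.2.1 t (ha.trans htab.1) i)
      simp [this, Real.zero_rpow hα.ne']

theorem aux_fluid_W {I J : ℕ} {A : Fin J → Fin I → ℝ} {C : Fin J → ℝ}
    {ν μ ρ : Fin I → ℝ} {Λ : (Fin I → ℝ) → Fin I → ℝ} {n : ℝ → Fin I → ℝ}
    (hμ : ∀ i, 0 < μ i) (hρ : ∀ i, ρ i = ν i / μ i)
    (h : IsFluidSol A C ν μ Λ n) {a b : ℝ} (ha : 0 ≤ a) (hab : a ≤ b) (j : Fin J)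
    (hj : ∑ i, A j i * ρ i = C j) :
    ∑ i, A j i * (n a i / μ i) ≤ ∑ i, A j i * (n b i / μ i) := by
  have key := aux_ac_drop (f := fun t => ∑ i, (-(A j i / μ i)) * n t i) (c := 0) hab ?_ ?_
  · have e : ∀ t, ∑ i, (-(A j i / μ i)) * n t i = - ∑ i, A j i * (n t i / μ i) := fun t => by
      rw [← Finset.sum_neg_distrib]
      refine Finset.sum_congr rfl fun i _ => ?_
      ring
    simp only [e] at key
    linarith
  · exact aux_ac_sum _ fun i _ => (aux_fluid_ac h ha hab i).const_mul _
  · filter_upwards [aux_fluid_ae h ha hab] with t ht htab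
    refine ⟨_, HasDerivAt.fun_sum fun i _ => ((ht htab).1 i).const_mul _, ?_⟩
    have h1 := (ht htab).2 j
    have : ∑ i, -(A j i / μ i) * (if 0 < n t i then ν i - μ i * Λ (n t) i else 0)
      = ∑ i, A j i * (if 0 < n t i then Λ (n t) i else ν i / μ i) - ∑ i, A j i * ρ i := by
      rw [← Finset.sum_sub_distrib]
      refine Finset.sum_congr rfl fun i _ => ?_
      have hm := (hμ i).ne'
      rw [hρ]
      split_ifs
      · field_simp; ring
      · ring
    rw [this]
    linarith

theorem aux_compact {I : ℕ} {α : ℝ} (hα : 0 < α) {d : Fin I → ℝ} (hd : ∀ i, 0 < d i) (B : ℝ) :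
    IsCompact {n : Fin I → ℝ | (∀ i, 0 ≤ n i) ∧ aux_F α d n ≤ B} := by
  have hα1 : 0 < α + 1 := by linarith
  refine (isCompact_univ_pi (s := fun i => Icc (0:ℝ) ((B / (d i / (α + 1))) ^ (α + 1)⁻¹))
    fun i => isCompact_Icc).of_isClosed_subset ?_ ?_
  · have e : {n : Fin I → ℝ | (∀ i, 0 ≤ n i) ∧ aux_F α d n ≤ B} =
        (⋂ i, {n : Fin I → ℝ | 0 ≤ n i}) ∩ {n | aux_F α d n ≤ B} := by
      ext n; simp
    rw [e]
    exact (isClosed_iInter fun i => isClosed_le continuous_const (continuous_apply i)).inter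
      (isClosed_le (aux_F_cont hα d) continuous_const)
  · rintro n ⟨h0, hB⟩ i -
    refine ⟨h0 i, ?_⟩
    have hdi : 0 < d i / (α + 1) := div_pos (hd i) hα1
    have h1 : d i / (α + 1) * n i ^ (α + 1) ≤ B := by
      refine le_trans ?_ hB
      unfold aux_F
      exact Finset.single_le_sum (f := fun i => d i / (α + 1) * n i ^ (α + 1))
        (fun k _ => mul_nonneg (div_pos (hd k) hα1).le (Real.rpow_nonneg (h0 k) _))
        (Finset.mem_univ i)
    have h2 : n i ^ (α + 1) ≤ B / (d i / (α + 1)) := by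
      rw [le_div_iff₀ hdi]; linarith
    calc n i = (n i ^ (α + 1)) ^ (α + 1)⁻¹ := (Real.rpow_rpow_inv (h0 i) hα1.ne').symm
      _ ≤ _ := Real.rpow_le_rpow (Real.rpow_nonneg (h0 i) _) h2 (by positivity)

/-- Near-minimality of `F` on the workload-feasible set gives closeness to a minimizer. -/
theorem aux_near {I J : ℕ} {A : Fin J → Fin I → ℝ} (hA : ∀ j i, 0 ≤ A j i)
    {C : Fin J → ℝ} {α : ℝ} (hα : 0 < α)
    {μ ρ d : Fin I → ℝ} (hμ : ∀ i, 0 < μ i) (hd : ∀ i, 0 < d i) (B ε : ℝ) (hε : 0 < ε) :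
    ∃ η > 0, ∀ n : Fin I → ℝ, (∀ i, 0 ≤ n i) → aux_F α d n ≤ B →
      (∀ m, aux_W A C ρ μ n m → aux_F α d n < aux_F α d m + η) →
      ∃ v : Fin I → ℝ, (∀ i, 0 ≤ v i) ∧
        (∀ m, aux_W A C ρ μ v m → aux_F α d v ≤ aux_F α d m) ∧
        Real.sqrt (∑ i, (v i - n i) ^ 2) < ε := by
  by_contra hcon
  push Not at hcon
  choose n hn0 hnB hnm hnv using fun k : ℕ => hcon (1 / ((k : ℝ) + 1)) (by positivity)
  obtain ⟨v, hv, φ, hφ, hlim⟩ := (aux_compact hα hd B).tendsto_subseq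
    (x := n) fun k => ⟨hn0 k, hnB k⟩
  have hmin : ∀ m, aux_W A C ρ μ v m → aux_F α d v ≤ aux_F α d m := by
    intro m hm
    have hc : Continuous fun x : Fin I → ℝ => fun i => m i + max (x i - v i) 0 := by fun_prop
    have t1 : Tendsto (fun k => aux_F α d (n (φ k))) atTop (𝓝 (aux_F α d v)) :=
      ((aux_F_cont hα d).tendsto v).comp hlim
    have t2 : Tendsto (fun k => aux_F α d (fun i => m i + max (n (φ k) i - v i) 0)) atTop
        (𝓝 (aux_F α d m)) := by
      have := (((aux_F_cont hα d).comp hc).tendsto v).comp hlim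
      simpa [Function.comp_def] using this
    have t3 : Tendsto (fun k => 1 / ((φ k : ℝ) + 1)) atTop (𝓝 0) :=
      tendsto_one_div_add_atTop_nhds_zero_nat.comp hφ.tendsto_atTop
    have t4 := t2.add t3
    rw [add_zero] at t4
    refine le_of_tendsto_of_tendsto' t1 t4 fun k => (hnm (φ k) _ ⟨fun i => ?_, fun j hj => ?_⟩).le
    · exact add_nonneg (hm.1 i) (le_max_right _ _)
    · have h1 := hm.2 j hj
      have h2 : ∑ i, A j i * (n (φ k) i / μ i) - ∑ i, A j i * (v i / μ i) ≤
          ∑ i, A j i * ((m i + max (n (φ k) i - v i) 0) / μ i) - ∑ i, A j i * (m i / μ i) := by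
        rw [← Finset.sum_sub_distrib, ← Finset.sum_sub_distrib]
        refine Finset.sum_le_sum fun i _ => ?_
        rw [← mul_sub, ← mul_sub, ← sub_div, ← sub_div, add_sub_cancel_left]
        refine mul_le_mul_of_nonneg_left ?_ (hA j i)
        exact div_le_div_of_nonneg_right (le_max_left _ _) (hμ i).le
      linarith
  have hc : Continuous fun x : Fin I → ℝ => Real.sqrt (∑ i, (v i - x i) ^ 2) := by fun_prop
  have t : Tendsto (fun k => Real.sqrt (∑ i, (v i - n (φ k) i) ^ 2)) atTop (𝓝 0) := by
    have := (hc.tendsto v).comp hlim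
    simpa [Function.comp_def] using this
  obtain ⟨k, hk⟩ := (t.eventually_lt_const hε).exists
  exact absurd hk (not_lt.2 (hnv (φ k) v hv.1 hmin))

theorem aux_far {I J : ℕ} {A : Fin J → Fin I → ℝ} (hA : ∀ j i, 0 ≤ A j i)
    {C : Fin J → ℝ} {α : ℝ} (hα : 0 < α)
    {κ μ ρ d : Fin I → ℝ} (hκ : ∀ i, 0 < κ i) (hμ : ∀ i, 0 < μ i) (hd0 : ∀ i, 0 < d i)
    (hρ : ∀ i, 0 < ρ i) (hρC : ∀ j, ∑ i, A j i * ρ i ≤ C j)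
    (hd : ∀ i, d i = κ i * ρ i ^ (-α) / μ i)
    {Λ : (Fin I → ℝ) → Fin I → ℝ}
    (hΛ : ∀ n : Fin I → ℝ, (∀ i, 0 ≤ n i) → IsAlloc A C α κ n (Λ n))
    (B η : ℝ) (hη : 0 < η) :
    ∃ δ > 0, ∀ n : Fin I → ℝ, (∀ i, 0 ≤ n i) → aux_F α d n ≤ B →
      (∃ m, aux_W A C ρ μ n m ∧ aux_F α d m + η ≤ aux_F α d n) →
      aux_K α κ ρ n (Λ n) ≤ -δ := by
  by_contra hcon
  push Not at hcon
  choose n hn0 hnB hm hK using fun k : ℕ => hcon (1 / ((k : ℝ) + 1)) (by positivity)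
  choose m hmW hmF using hm
  have hcp := aux_compact hα hd0 B
  obtain ⟨⟨v, w⟩, ⟨hv, hw⟩, φ, hφ, hlim⟩ := (hcp.prod hcp).tendsto_subseq
    (x := fun k => (n k, m k)) fun k => ⟨⟨hn0 k, hnB k⟩, (hmW k).1, by
      have := hmF k
      have := hnB k
      show aux_F α d (m k) ≤ B
      linarith⟩
  have hl1 : Tendsto (fun k => n (φ k)) atTop (𝓝 v) := (continuous_fst.tendsto (v, w)).comp hlim
  have hl2 : Tendsto (fun k => m (φ k)) atTop (𝓝 w) := (continuous_snd.tendsto (v, w)).comp hlim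
  have hF : aux_F α d w + η ≤ aux_F α d v :=
    le_of_tendsto_of_tendsto' ((((aux_F_cont hα d).tendsto w).comp hl2).add_const η)
      (((aux_F_cont hα d).tendsto v).comp hl1) fun k => hmF (φ k)
  have hW : aux_W A C ρ μ v w := by
    refine ⟨hw.1, fun j hj => ?_⟩
    have hc : Continuous fun x : Fin I → ℝ => ∑ i, A j i * (x i / μ i) := by fun_prop
    exact le_of_tendsto_of_tendsto' ((hc.tendsto v).comp hl1) ((hc.tendsto w).comp hl2)
      fun k => (hmW (φ k)).2 j hj
  have := aux_var hα hκ hμ hv.1 hρ hρC hd hW fun L hL hLC => ?_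
  · linarith
  · have hc : Continuous fun x : Fin I → ℝ =>
        ∑ i, κ i * x i ^ α * (aux_u α (ρ i) - aux_u α (L i)) := by
      refine continuous_finsetSum _ fun i _ => ?_
      exact (continuous_const.mul ((continuous_apply i).rpow_const fun _ => Or.inr hα.le)).mul
        continuous_const
    have t3 : Tendsto (fun k => -(1 / ((φ k : ℝ) + 1))) atTop (𝓝 0) := by
      have := (tendsto_one_div_add_atTop_nhds_zero_nat (𝕜 := ℝ)).comp hφ.tendsto_atTop
      simpa using this.neg
    refine le_of_tendsto_of_tendsto' t3 ((hc.tendsto v).comp hl1) fun k => ?_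
    exact (hK (φ k)).le.trans
      (aux_K_le hA hα hκ (hn0 _) hρ hρC (hΛ _ (hn0 _)) L hL hLC)

end aux

theorem stmt7 {I J : ℕ} (hI : 0 < I) (hJ : 0 < J)
    (A : Fin J → Fin I → ℝ) (hA01 : ∀ j i, A j i = 0 ∨ A j i = 1)
    (hAcol : ∀ i, ∃ j, A j i = 1) (hArank : LinearIndependent ℝ A)
    (C : Fin J → ℝ) (hC : ∀ j, 0 < C j)
    (α : ℝ) (hα : 0 < α) (κ : Fin I → ℝ) (hκ : ∀ i, 0 < κ i)
    (ν μ : Fin I → ℝ) (hν : ∀ i, 0 < ν i) (hμ : ∀ i, 0 < μ i)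
    (hload : ∀ j, (∑ i, A j i * (ν i / μ i)) ≤ C j)
    (hJs : (Jstar A C ν μ).Nonempty)
    (Λ : (Fin I → ℝ) → Fin I → ℝ)
    (hΛ : ∀ n : Fin I → ℝ, (∀ i, 0 ≤ n i) → IsAlloc A C α κ n (Λ n)) :
    ∀ R > (0:ℝ), ∀ ε > (0:ℝ), ∃ T : ℝ, ∀ n : ℝ → Fin I → ℝ,
      IsFluidSol A C ν μ Λ n → Real.sqrt (∑ i, (n 0 i) ^ 2) ≤ R →
      ∀ t > T, ∃ v : Fin I → ℝ,
        ((∀ i, 0 ≤ v i) ∧ IsFluidSol A C ν μ Λ fun _ => v) ∧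
        Real.sqrt (∑ i, (v i - n t i) ^ 2) < ε := by

  intro R hR ε hε
  have hA : ∀ j i, 0 ≤ A j i := fun j i => by
    rcases hA01 j i with h | h <;> rw [h]
    exact zero_le_one
  set ρ : Fin I → ℝ := fun i => ν i / μ i with hρdef
  have hρ : ∀ i, 0 < ρ i := fun i => div_pos (hν i) (hμ i)
  set d : Fin I → ℝ := fun i => κ i * ρ i ^ (-α) / μ i with hddef
  have hd0 : ∀ i, 0 < d i := fun i =>
    div_pos (mul_pos (hκ i) (Real.rpow_pos_of_pos (hρ i) _)) (hμ i)
  have hα1 : 0 < α + 1 := by linarith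
  set B : ℝ := aux_F α d (fun _ => R) with hB
  obtain ⟨η, hη, hnear⟩ := aux_near (C := C) (ρ := ρ) hA hα hμ hd0 B ε hε
  obtain ⟨δ, hδ, hfar⟩ := aux_far hA hα hκ hμ hd0 hρ hload (fun _ => rfl) hΛ B η hη
  have hF0 : ∀ n : Fin I → ℝ, (∀ i, 0 ≤ n i) → 0 ≤ aux_F α d n := fun n hn =>
    Finset.sum_nonneg fun i _ => mul_nonneg (div_pos (hd0 i) hα1).le (Real.rpow_nonneg (hn i) _)
  have hB0 : 0 ≤ B := hF0 _ fun _ => hR.le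
  have hT0 : 0 ≤ B / δ + 1 := by positivity
  refine ⟨B / δ + 1, fun n hn hnR t ht => ?_⟩
  have hnn := hn.2.1
  have hmono : ∀ a b : ℝ, 0 ≤ a → a ≤ b → aux_F α d (n b) ≤ aux_F α d (n a) := by
    intro a b ha hab
    have := aux_fluid_F hα (κ := κ) (ρ := ρ) (d := d) (c := 0) hμ (fun _ => rfl)
      (fun _ => rfl) hn ha hab fun s hs => ?_
    · linarith
    · have hs0 := hnn s (ha.trans hs.1)
      have := aux_K_le hA hα hκ hs0 hρ hload (hΛ _ hs0) ρ hρ hload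
      simpa using this
  have hFB0 : aux_F α d (n 0) ≤ B := by
    refine Finset.sum_le_sum fun i _ => ?_
    refine mul_le_mul_of_nonneg_left ?_ (div_pos (hd0 i) hα1).le
    refine Real.rpow_le_rpow (hnn 0 (mem_Ici.2 le_rfl) i) ?_ hα1.le
    refine le_trans ?_ hnR
    refine Real.le_sqrt_of_sq_le ?_
    exact Finset.single_le_sum (f := fun i => n 0 i ^ 2) (fun k _ => sq_nonneg _)
      (Finset.mem_univ i)
  have hFB : ∀ s, 0 ≤ s → aux_F α d (n s) ≤ B := fun s hs =>
    (hmono 0 s le_rfl hs).trans hFB0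
  have hex : ∃ s ∈ Icc 0 (B / δ + 1),
      ∀ m, aux_W A C ρ μ (n s) m → aux_F α d (n s) < aux_F α d m + η := by
    by_contra hcon
    push Not at hcon
    have := aux_fluid_F hα (κ := κ) (ρ := ρ) (d := d) (c := -δ) hμ (fun _ => rfl)
      (fun _ => rfl) hn le_rfl hT0 fun s hs =>
        hfar _ (hnn s hs.1) (hFB s hs.1) (hcon s hs)
    have h0 := hF0 _ (hnn (B / δ + 1) hT0)
    have h1 : -δ * (B / δ + 1 - 0) = -B - δ := by field_simp; ring
    linarith
  obtain ⟨s, hs, hsm⟩ := hex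
  have hst : s ≤ t := hs.2.trans ht.le
  have ht0 : 0 ≤ t := hs.1.trans hst
  obtain ⟨v, hv0, hvm, hvε⟩ := hnear (n t) (hnn t ht0) (hFB t ht0) fun m hm =>
    lt_of_le_of_lt (hmono s t hs.1 hst) (hsm m ⟨hm.1, fun j hj =>
      (aux_fluid_W hμ (fun _ => rfl) hn hs.1 hst j hj).trans (hm.2 j hj)⟩)
  refine ⟨v, ⟨hv0, ?_⟩, hvε⟩
  have hal := hΛ v hv0
  have hK := aux_inv hα (κ := κ) (d := d) hμ hv0 hρ (fun _ => rfl) hal.1 hvm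
  have hinv := aux_K_eq hA hα hκ hv0 hρ hload hal hK
  refine ⟨fun i T hT e he => ⟨1, one_pos, fun m a b _ _ _ => by simpa using he⟩,
    fun t _ i => hv0 i, fun t _ _ => ⟨fun i => ⟨fun hi => ?_, fun _ => hasDerivWithinAt_const _ _ _⟩,
      fun j => ?_⟩⟩
  · have h1 : ν i - μ i * Λ v i = 0 := by
      rw [hinv i hi, hρdef]
      have := (hμ i).ne'
      field_simp
      ring
    simp only [h1]
    exact hasDerivWithinAt_const _ _ _
  · refine le_trans (le_of_eq (Finset.sum_congr rfl fun i _ => ?_)) (hload j)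
    split_ifs with hi
    · rw [hinv i hi]
    · rfl
end
end

section
/- A vector n ∈ ℝ₊^I is an invariant state if and only if n = Δ(w(n)). -/
open Real Set

noncomputable section

/-- scalar utility -/
def gsc (α x : ℝ) : ℝ := if α = 1 then Real.log x else x ^ (1 - α) / (1 - α)

theorem aux_bern {q u : ℝ} (hq : q ≠ 0) (hq1 : q < 1) (hu : 0 ≤ u) (hu' : q < 0 → 0 < u)
    (hu1 : u ≠ 1) : u ^ q / q < 1 / q + (u - 1) := by
  rcases lt_or_gt_of_ne hq with h | h
  · have hu0 := hu' h
    have h1 : 1 + q * (u - 1) < u ^ q := by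
      rw [Real.rpow_def_of_pos hu0]
      have h2 := Real.add_one_le_exp (Real.log u * q)
      have h3 := Real.log_lt_sub_one_of_pos hu0 hu1
      nlinarith
    have : u ^ q / q < (1 + q * (u - 1)) / q := div_lt_div_of_neg_of_lt h h1
    calc _ < _ := this
      _ = _ := by field_simp
  · have h1 := rpow_one_add_lt_one_add_mul_self (s := u - 1) (by linarith)
      (sub_ne_zero.mpr hu1) h hq1
    rw [add_sub_cancel] at h1
    have : u ^ q / q < (1 + q * (u - 1)) / q := div_lt_div_of_pos_right h1 h
    calc _ < _ := this
      _ = _ := by field_simp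

theorem gsc_lt {α r x : ℝ} (hα : 0 < α) (hr : 0 < r) (hx : 0 ≤ x) (hx' : 1 ≤ α → 0 < x)
    (hne : x ≠ r) : gsc α x < gsc α r + r ^ (-α) * (x - r) := by
  have hu1 : x / r ≠ 1 := by
    rw [Ne, div_eq_one_iff_eq hr.ne']; exact hne
  unfold gsc
  split_ifs with h
  · subst h
    have hx0 := hx' le_rfl
    have := Real.log_lt_sub_one_of_pos (div_pos hx0 hr) hu1
    rw [Real.log_div hx0.ne' hr.ne'] at this
    rw [Real.rpow_neg_one]
    have e : r⁻¹ * (x - r) = x / r - 1 := by field_simp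
    rw [e]; linarith
  · have hq : (1 - α) ≠ 0 := sub_ne_zero.mpr (Ne.symm h)
    have h1 := aux_bern (q := 1 - α) (u := x / r) hq (by linarith) (by positivity)
      (fun h => div_pos (hx' (by linarith)) hr) hu1
    rw [Real.div_rpow hx hr.le] at h1
    have hp : 0 < r ^ (1 - α) := Real.rpow_pos_of_pos hr _
    have h2 := mul_lt_mul_of_pos_left h1 hp
    have e : r ^ (-α) = r ^ (1 - α) / r := by
      rw [← Real.rpow_sub_one hr.ne']; congr 1; ring
    rw [e]
    calc _ = r ^ (1 - α) * (x ^ (1 - α) / r ^ (1 - α) / (1 - α)) := by field_simp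
      _ < _ := h2
      _ = _ := by field_simp

theorem gsc_deriv {α r : ℝ} (hr : 0 < r) : HasDerivAt (gsc α) (r ^ (-α)) r := by
  unfold gsc
  split_ifs with h
  · subst h; rw [Real.rpow_neg_one]; exact Real.hasDerivAt_log hr.ne'
  · have hq : (1 - α) ≠ 0 := sub_ne_zero.mpr (Ne.symm h)
    have := (Real.hasDerivAt_rpow_const (x := r) (p := 1 - α) (Or.inl hr.ne')).div_const (1 - α)
    have e : (1 - α) * r ^ (1 - α - 1) / (1 - α) = r ^ (-α) := by
      rw [mul_div_right_comm, div_self hq, one_mul]; congr 1; ring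
    rw [e] at this
    exact this

theorem fsc_lt {α a x : ℝ} (hα : 0 < α) (ha : 0 ≤ a) (hx : 0 ≤ x) (hne : x ≠ a) :
    a ^ (α + 1) + (α + 1) * a ^ α * (x - a) < x ^ (α + 1) := by
  rcases ha.eq_or_lt with rfl | ha
  · rw [Real.zero_rpow (by linarith), Real.zero_rpow hα.ne']
    have := Real.rpow_pos_of_pos (lt_of_le_of_ne hx (Ne.symm hne)) (α + 1)
    simpa using this
  · have hu1 : x / a ≠ 1 := by
      rw [Ne, div_eq_one_iff_eq ha.ne']; exact hne
    have h0 : 0 ≤ x / a := by positivity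
    have h1 := one_add_mul_self_lt_rpow_one_add (s := x / a - 1) (p := α + 1) (by linarith)
      (sub_ne_zero.mpr hu1) (by linarith)
    rw [add_sub_cancel, Real.div_rpow hx ha.le] at h1
    have hp : 0 < a ^ (α + 1) := Real.rpow_pos_of_pos ha _
    have h2 := mul_lt_mul_of_pos_left h1 hp
    have e : a ^ α = a ^ (α + 1) / a := by
      rw [← Real.rpow_sub_one ha.ne']; congr 1; ring
    rw [e]
    calc _ = a ^ (α + 1) * (1 + (α + 1) * (x / a - 1)) := by field_simp
      _ < _ := h2
      _ = _ := by field_simp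

theorem deriv_nonpos_aux {φ : ℝ → ℝ} {D : ℝ} (h : HasDerivAt φ D 0)
    (hle : ∀ t, 0 < t → t ≤ 1 → φ t ≤ φ 0) : D ≤ 0 := by
  have h1 := (hasDerivAt_iff_tendsto_slope_zero.mp h).mono_left
    (nhdsWithin_mono (0:ℝ) (show Ioi (0:ℝ) ⊆ {0}ᶜ from fun x hx => ne_of_gt hx))
  refine le_of_tendsto h1 ?_
  filter_upwards [Ioc_mem_nhdsGT (zero_lt_one (α := ℝ))] with t ht
  have := hle t ht.1 ht.2
  rw [zero_add, smul_eq_mul]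
  exact mul_nonpos_of_nonneg_of_nonpos (inv_nonneg.mpr ht.1.le) (by linarith)

theorem Gfun_real {I : ℕ} {α : ℝ} (hα : 0 < α) (κ n L : Fin I → ℝ) (hn : ∀ i, 0 ≤ n i)
    (h : 1 ≤ α → ∀ i, 0 < n i → L i ≠ 0) :
    Gfun α κ n L = ((∑ i, κ i * n i ^ α * gsc α (L i) : ℝ) : EReal) := by
  unfold Gfun
  rw [if_neg (by rintro ⟨h1, i, h2, h3⟩; exact h h1 i h2 h3)]
  have key : ∀ i, ¬ 0 < n i → n i ^ α = 0 := fun i hi => by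
    rw [le_antisymm (not_lt.mp hi) (hn i), Real.zero_rpow hα.ne']
  split_ifs with h1
  · congr 1
    refine Finset.sum_congr rfl fun i _ => ?_
    split_ifs with h2
    · simp [gsc, h1]
    · simp [key i h2]
  · congr 1
    refine Finset.sum_congr rfl fun i _ => ?_
    split_ifs with h2
    · simp [gsc, h1]; ring
    · simp [key i h2]

theorem alloc_iff {I J : ℕ}
    (A : Fin J → Fin I → ℝ) (hA01 : ∀ j i, A j i = 0 ∨ A j i = 1)
    (C : Fin J → ℝ)
    (α : ℝ) (hα : 0 < α) (κ : Fin I → ℝ) (hκ : ∀ i, 0 < κ i)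
    (ρ : Fin I → ℝ) (hρ : ∀ i, 0 < ρ i)
    (hload : ∀ j, (∑ i, A j i * ρ i) ≤ C j)
    (n : Fin I → ℝ) (hn : ∀ i, 0 ≤ n i) (M : Fin I → ℝ) (hM : IsAlloc A C α κ n M) :
    (∀ i, 0 < n i → M i = ρ i) ↔
      ∀ L ∈ Feasible A C n, ∑ i, κ i * n i ^ α * ρ i ^ (-α) * (L i - ρ i) ≤ 0 := by
  have key : ∀ i, ¬ 0 < n i → n i ^ α = 0 := fun i hi => by
    rw [le_antisymm (not_lt.mp hi) (hn i), Real.zero_rpow hα.ne']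
  have key2 : ∀ i, ¬ 0 < n i → n i = 0 := fun i hi => le_antisymm (not_lt.mp hi) (hn i)
  constructor
  · intro h L hL
    have hG : ∀ t, 0 < t → t ≤ 1 / 2 →
        ∑ i, κ i * n i ^ α * gsc α (ρ i + t * (L i - ρ i)) ≤ ∑ i, κ i * n i ^ α * gsc α (ρ i) := by
      intro t ht0 ht1
      set L' : Fin I → ℝ := fun i => M i + t * (L i - M i) with hL'
      have hpos : ∀ i, 0 < n i → 0 < L' i := by
        intro i hi
        simp only [hL', h i hi]
        nlinarith [hρ i, hL.1 i, mul_nonneg ht0.le (hL.1 i)]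
      have hfe : L' ∈ Feasible A C n := by
        refine ⟨fun i => ?_, fun i hi => ?_, fun j => ?_⟩
        · have := hL.1 i; have := hM.1.1 i
          simp only [hL']
          nlinarith [mul_nonneg ht0.le (hL.1 i)]
        · simp [hL', hL.2.1 i hi, hM.1.2.1 i hi]
        · have e : ∑ i, A j i * L' i = (1 - t) * ∑ i, A j i * M i + t * ∑ i, A j i * L i := by
            rw [Finset.mul_sum, Finset.mul_sum, ← Finset.sum_add_distrib]
            refine Finset.sum_congr rfl fun i _ => ?_
            simp only [hL']; ring
          rw [e]
          nlinarith [hL.2.2 j, hM.1.2.2 j]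
      have h1 := hM.2 L' hfe
      rw [Gfun_real hα κ n L' hn (fun _ i hi => (hpos i hi).ne'),
        Gfun_real hα κ n M hn (fun _ i hi => by rw [h i hi]; exact (hρ i).ne'),
        EReal.coe_le_coe_iff] at h1
      convert h1 using 1
      · refine Finset.sum_congr rfl fun i _ => ?_
        by_cases hi : 0 < n i
        · simp only [hL', h i hi]
        · simp [key i hi]
      · refine Finset.sum_congr rfl fun i _ => ?_
        by_cases hi : 0 < n i
        · rw [h i hi]
        · simp [key i hi]
    have hd : HasDerivAt (fun s : ℝ => ∑ i, κ i * n i ^ α * gsc α (ρ i + (s / 2) * (L i - ρ i)))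
        (∑ i, κ i * n i ^ α * (ρ i ^ (-α) * ((1 / 2) * (L i - ρ i)))) 0 := by
      refine HasDerivAt.fun_sum fun i _ => ?_
      refine HasDerivAt.const_mul _ ?_
      have h1 : HasDerivAt (fun s : ℝ => ρ i + (s / 2) * (L i - ρ i))
          ((1 / 2) * (L i - ρ i)) 0 :=
        (((hasDerivAt_id (0:ℝ)).div_const 2).mul_const (L i - ρ i)).const_add (ρ i)
      have h2 : HasDerivAt (gsc α) (ρ i ^ (-α)) (ρ i + ((0:ℝ) / 2) * (L i - ρ i)) := by
        simpa using gsc_deriv (α := α) (hρ i)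
      exact h2.comp (0:ℝ) h1
    have h3 := deriv_nonpos_aux hd (fun t ht0 ht1 => by
      have := hG (t / 2) (by linarith) (by linarith)
      simpa using this)
    have e : ∑ i, κ i * n i ^ α * (ρ i ^ (-α) * ((1 / 2) * (L i - ρ i))) =
        (1 / 2) * ∑ i, κ i * n i ^ α * ρ i ^ (-α) * (L i - ρ i) := by
      rw [Finset.mul_sum]; exact Finset.sum_congr rfl fun i _ => by ring
    rw [e] at h3
    linarith
  · intro h
    by_contra! hc
    obtain ⟨k, hk, hkne⟩ := hc
    set R : Fin I → ℝ := fun i => if 0 < n i then ρ i else 0 with hR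
    have hRf : R ∈ Feasible A C n := by
      refine ⟨fun i => ?_, fun i hi => ?_, fun j => ?_⟩
      · simp only [hR]; split_ifs; exacts [(hρ i).le, le_rfl]
      · simp [hR, hi]
      · refine le_trans (Finset.sum_le_sum fun i _ => ?_) (hload j)
        refine mul_le_mul_of_nonneg_left ?_ (by rcases hA01 j i with h | h <;> simp [h])
        simp only [hR]; split_ifs; exacts [le_rfl, (hρ i).le]
    have h1 := hM.2 R hRf
    rw [Gfun_real hα κ n R hn (fun _ i hi => by simp [hR, hi, (hρ i).ne'])] at h1
    have hMpos : 1 ≤ α → ∀ i, 0 < n i → M i ≠ 0 := by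
      intro ha i hi h0
      have : Gfun α κ n M = ⊥ := by
        unfold Gfun; rw [if_pos ⟨ha, i, hi, h0⟩]
      rw [this] at h1
      exact absurd h1 (not_le.mpr (EReal.bot_lt_coe _))
    rw [Gfun_real hα κ n M hn hMpos, EReal.coe_le_coe_iff] at h1
    have h2 : ∑ i, κ i * n i ^ α * gsc α (M i) <
        ∑ i, (κ i * n i ^ α * gsc α (R i) + κ i * n i ^ α * ρ i ^ (-α) * (M i - ρ i)) := by
      have hlt : ∀ i, 0 < n i → M i ≠ ρ i → κ i * n i ^ α * gsc α (M i) <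
          κ i * n i ^ α * gsc α (R i) + κ i * n i ^ α * ρ i ^ (-α) * (M i - ρ i) := by
        intro i hi hne
        have := gsc_lt hα (hρ i) (hM.1.1 i)
          (fun ha => lt_of_le_of_ne (hM.1.1 i) (Ne.symm (hMpos ha i hi))) hne
        have hp : 0 < κ i * n i ^ α := mul_pos (hκ i) (Real.rpow_pos_of_pos hi _)
        have := mul_lt_mul_of_pos_left this hp
        simp only [hR, hi, if_true]
        linarith
      refine Finset.sum_lt_sum (fun i _ => ?_) ⟨k, Finset.mem_univ _, hlt k hk hkne⟩
      by_cases hi : 0 < n i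
      · by_cases hne : M i = ρ i
        · simp [hR, hi, hne]
        · exact (hlt i hi hne).le
      · simp [key i hi]
    rw [Finset.sum_add_distrib] at h2
    have := h M hM.1
    linarith

theorem coef_eq {α m ν μ : ℝ} (hν : 0 < ν) (hμ : 0 < μ) (hm : 0 ≤ m) :
    μ ^ (α - 1) * (m / ν) ^ α = m ^ α * (ν / μ) ^ (-α) / μ := by
  have h1 := Real.rpow_pos_of_pos hν α
  have h2 := Real.rpow_pos_of_pos hμ α
  rw [Real.rpow_sub_one hμ.ne', Real.div_rpow hm hν.le, Real.rpow_neg (by positivity),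
    Real.div_rpow hν.le hμ.le]
  field_simp

theorem delta_iff {I J : ℕ}
    (A : Fin J → Fin I → ℝ) (C : Fin J → ℝ)
    (α : ℝ) (hα : 0 < α) (κ : Fin I → ℝ) (hκ : ∀ i, 0 < κ i)
    (ν μ : Fin I → ℝ) (hν : ∀ i, 0 < ν i) (hμ : ∀ i, 0 < μ i)
    (n : Fin I → ℝ) (hn : ∀ i, 0 ≤ n i) (D : Fin I → ℝ)
    (hD : D ∈ WFeasible A C ν μ (wl A μ n) ∧
        ∀ m ∈ WFeasible A C ν μ (wl A μ n), Ffun α κ ν μ D ≤ Ffun α κ ν μ m) :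
    n = D ↔ ∀ m ∈ WFeasible A C ν μ (wl A μ n),
      0 ≤ ∑ i, κ i * n i ^ α * (ν i / μ i) ^ (-α) * ((m i - n i) / μ i) := by
  have hα1 : 0 < α + 1 := by linarith
  have hnf : n ∈ WFeasible A C ν μ (wl A μ n) := ⟨hn, fun j _ => le_rfl⟩
  constructor
  · rintro rfl m hm
    have hd : HasDerivAt (fun s : ℝ => - Ffun α κ ν μ (fun i => n i + s * (m i - n i)))
        (-((1 / (α + 1)) * ∑ i, ν i * κ i * μ i ^ (α - 1) *
          (((α + 1) * (n i / ν i) ^ α) * ((m i - n i) / ν i)))) 0 := by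
      unfold Ffun
      refine HasDerivAt.fun_neg (HasDerivAt.const_mul _ (HasDerivAt.fun_sum fun i _ => ?_))
      refine HasDerivAt.const_mul _ ?_
      have h1 : HasDerivAt (fun s : ℝ => (n i + s * (m i - n i)) / ν i)
          ((m i - n i) / ν i) 0 := by
        simpa using (((hasDerivAt_id (0:ℝ)).mul_const (m i - n i)).const_add (n i)).div_const (ν i)
      have h2 : HasDerivAt (fun x : ℝ => x ^ (α + 1)) ((α + 1) * (n i / ν i) ^ α)
          ((n i + (0:ℝ) * (m i - n i)) / ν i) := by
        have := Real.hasDerivAt_rpow_const (x := n i / ν i) (p := α + 1) (Or.inr (by linarith))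
        simpa using this
      exact h2.comp (0:ℝ) h1
    have h3 := deriv_nonpos_aux hd (fun t ht0 ht1 => by
      simp only [zero_mul, add_zero]
      refine neg_le_neg (hD.2 _ ⟨fun i => ?_, fun j hj => ?_⟩)
      · nlinarith [mul_nonneg ht0.le (hm.1 i), hn i]
      · have h4 := hm.2 j hj
        have e : ∑ i, A j i * (n i + t * (m i - n i)) / μ i =
            (1 - t) * ∑ i, A j i * n i / μ i + t * ∑ i, A j i * m i / μ i := by
          rw [Finset.mul_sum, Finset.mul_sum, ← Finset.sum_add_distrib]
          refine Finset.sum_congr rfl fun i _ => ?_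
          ring
        rw [e]
        unfold wl at h4 ⊢
        nlinarith)
    have e : (1 / (α + 1)) * ∑ i, ν i * κ i * μ i ^ (α - 1) *
          (((α + 1) * (n i / ν i) ^ α) * ((m i - n i) / ν i)) =
        ∑ i, κ i * n i ^ α * (ν i / μ i) ^ (-α) * ((m i - n i) / μ i) := by
      rw [Finset.mul_sum]
      refine Finset.sum_congr rfl fun i _ => ?_
      have := coef_eq (α := α) (hν i) (hμ i) (hn i)
      have h5 := (hν i).ne'
      calc _ = κ i * (μ i ^ (α - 1) * (n i / ν i) ^ α) * (m i - n i) := by field_simp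
        _ = _ := by rw [this]; ring
    rw [e] at h3
    linarith
  · intro h
    by_contra hne
    obtain ⟨k, hk⟩ : ∃ k, D k ≠ n k := by
      by_contra! hc; exact hne (funext fun i => (hc i).symm)
    have h1 := hD.2 n hnf
    have h2 := h D hD.1
    have h3 : ∑ i, (1 / (α + 1) * (ν i * κ i * μ i ^ (α - 1) * (n i / ν i) ^ (α + 1)) +
        κ i * n i ^ α * (ν i / μ i) ^ (-α) * ((D i - n i) / μ i)) <
        ∑ i, 1 / (α + 1) * (ν i * κ i * μ i ^ (α - 1) * (D i / ν i) ^ (α + 1)) := by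
      have hlt : ∀ i, D i ≠ n i →
          1 / (α + 1) * (ν i * κ i * μ i ^ (α - 1) * (n i / ν i) ^ (α + 1)) +
            κ i * n i ^ α * (ν i / μ i) ^ (-α) * ((D i - n i) / μ i) <
          1 / (α + 1) * (ν i * κ i * μ i ^ (α - 1) * (D i / ν i) ^ (α + 1)) := by
        intro i hi
        have hνi := hν i
        have := fsc_lt hα (div_nonneg (hn i) (hν i).le) (div_nonneg (hD.1.1 i) (hν i).le)
          (fun h => hi (by rwa [div_left_inj' hνi.ne'] at h))
        have hp : 0 < 1 / (α + 1) * (ν i * κ i * μ i ^ (α - 1)) := by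
          have := Real.rpow_pos_of_pos (hμ i) (α - 1)
          have := hκ i
          positivity
        have h4 := mul_lt_mul_of_pos_left this hp
        have h5 := coef_eq (α := α) (hν i) (hμ i) (hn i)
        have h6 : κ i * n i ^ α * (ν i / μ i) ^ (-α) * ((D i - n i) / μ i) =
            1 / (α + 1) * (ν i * κ i * μ i ^ (α - 1)) *
              ((α + 1) * (n i / ν i) ^ α * (D i / ν i - n i / ν i)) := by
          calc _ = κ i * (n i ^ α * (ν i / μ i) ^ (-α) / μ i) * (D i - n i) := by ring
            _ = κ i * (μ i ^ (α - 1) * (n i / ν i) ^ α) * (D i - n i) := by rw [h5]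
            _ = _ := by field_simp
        rw [h6]
        linarith
      refine Finset.sum_lt_sum (fun i _ => ?_) ⟨k, Finset.mem_univ _, hlt k hk⟩
      by_cases hi : D i = n i
      · simp [hi]
      · exact (hlt i hi).le
    rw [Finset.sum_add_distrib, ← Finset.mul_sum, ← Finset.mul_sum] at h3
    unfold Ffun at h1
    linarith

theorem exists_small {ι : Type*} [Fintype ι] (P : ι → ℝ → Prop)
    (h : ∀ i, ∃ ε > (0:ℝ), ∀ t, 0 < t → t ≤ ε → P i t) :
    ∃ ε > (0:ℝ), ∀ t, 0 < t → t ≤ ε → ∀ i, P i t := by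
  choose ε hε hP using h
  rcases isEmpty_or_nonempty ι with hE | hE
  · exact ⟨1, one_pos, fun t _ _ i => hE.elim i⟩
  · obtain ⟨k, hk⟩ := Finite.exists_min ε
    exact ⟨ε k, hε k, fun t h0 h1 i => hP i t h0 (h1.trans (hk i))⟩

/-- for `a > 0`, and any `b`, `t * b ≤ a` for small `t` -/
theorem small_mul_le_aux {a : ℝ} (ha : 0 < a) (b : ℝ) :
    ∃ ε > (0:ℝ), ∀ t, 0 < t → t ≤ ε → t * b ≤ a := by
  refine ⟨a / (|b| + 1), by positivity, fun t h0 h1 => ?_⟩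
  rw [le_div_iff₀ (by positivity)] at h1
  nlinarith [le_abs_self b, mul_le_mul_of_nonneg_left (le_abs_self b) h0.le]

theorem foc_iff {I J : ℕ}
    (A : Fin J → Fin I → ℝ) (hA01 : ∀ j i, A j i = 0 ∨ A j i = 1)
    (C : Fin J → ℝ) (ν μ : Fin I → ℝ) (hν : ∀ i, 0 < ν i) (hμ : ∀ i, 0 < μ i)
    (hload : ∀ j, (∑ i, A j i * (ν i / μ i)) ≤ C j)
    (n : Fin I → ℝ) (hn : ∀ i, 0 ≤ n i) (p : Fin I → ℝ) (hp : ∀ i, n i = 0 → p i = 0) :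
    (∀ L ∈ Feasible A C n, ∑ i, p i * (L i - ν i / μ i) ≤ 0) ↔
    (∀ m ∈ WFeasible A C ν μ (wl A μ n), 0 ≤ ∑ i, p i * ((m i - n i) / μ i)) := by
  have hρ : ∀ i, 0 < ν i / μ i := fun i => div_pos (hν i) (hμ i)
  have hA0 : ∀ j i, 0 ≤ A j i := fun j i => by rcases hA01 j i with h | h <;> simp [h]
  have key2 : ∀ i, ¬ 0 < n i → n i = 0 := fun i hi => le_antisymm (not_lt.mp hi) (hn i)
  constructor
  · intro h m hm
    set y : Fin I → ℝ := fun i => (m i - n i) / μ i with hy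
    have hAy : ∀ j ∈ Jstar A C ν μ, 0 ≤ ∑ i, A j i * y i := by
      intro j hj
      have h1 := hm.2 j hj
      unfold wl at h1
      have e : ∑ i, A j i * y i = ∑ i, A j i * m i / μ i - ∑ i, A j i * n i / μ i := by
        rw [← Finset.sum_sub_distrib]
        refine Finset.sum_congr rfl fun i _ => ?_
        simp only [hy]; ring
      rw [e]; linarith
    obtain ⟨ε₁, hε₁, H1⟩ := exists_small (fun i t => t * y i ≤ ν i / μ i)
      (fun i => small_mul_le_aux (hρ i) (y i))
    obtain ⟨ε₂, hε₂, H2⟩ := exists_small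
      (fun j t => j ∉ Jstar A C ν μ → t * (∑ i, if 0 < n i then A j i * (- y i) else 0)
        ≤ C j - ∑ i, A j i * (ν i / μ i))
      (fun j => by
        by_cases hj : j ∈ Jstar A C ν μ
        · exact ⟨1, one_pos, fun t _ _ h => absurd hj h⟩
        · have hlt : 0 < C j - ∑ i, A j i * (ν i / μ i) :=
            sub_pos.mpr (lt_of_le_of_ne (hload j) hj)
          obtain ⟨ε, h0, h1⟩ := small_mul_le_aux hlt (∑ i, if 0 < n i then A j i * (- y i) else 0)
          exact ⟨ε, h0, fun t a b _ => h1 t a b⟩)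
    set t := min ε₁ ε₂ with ht
    have ht0 : 0 < t := lt_min hε₁ hε₂
    have H1 := H1 t ht0 (min_le_left _ _)
    have H2 := H2 t ht0 (min_le_right _ _)
    have hL : (fun i => if 0 < n i then ν i / μ i - t * y i else 0) ∈ Feasible A C n := by
      refine ⟨fun i => ?_, fun i hi => ?_, fun j => ?_⟩
      · dsimp only
        split_ifs
        · linarith [H1 i]
        · exact le_rfl
      · simp [hi]
      · by_cases hj : j ∈ Jstar A C ν μ
        · have h1 : ∑ i, A j i * (if 0 < n i then ν i / μ i - t * y i else 0) ≤
              ∑ i, (A j i * (ν i / μ i) - t * (A j i * y i)) := by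
            refine Finset.sum_le_sum fun i _ => ?_
            split_ifs with hi
            · exact le_of_eq (by ring)
            · have := mul_nonneg (hA0 j i) (sub_nonneg.mpr (H1 i))
              rw [mul_zero]
              linarith
          rw [Finset.sum_sub_distrib, ← Finset.mul_sum] at h1
          have := mul_nonneg ht0.le (hAy j hj)
          linarith [hload j]
        · have h1 : ∑ i, A j i * (if 0 < n i then ν i / μ i - t * y i else 0) ≤
              ∑ i, (A j i * (ν i / μ i) + t * (if 0 < n i then A j i * (- y i) else 0)) := by
            refine Finset.sum_le_sum fun i _ => ?_
            split_ifs with hi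
            · exact le_of_eq (by ring)
            · have := mul_nonneg (hA0 j i) (hρ i).le
              linarith
          rw [Finset.sum_add_distrib, ← Finset.mul_sum] at h1
          linarith [H2 j hj]
    have h3 := h _ hL
    have e : ∑ i, p i * ((if 0 < n i then ν i / μ i - t * y i else 0) - ν i / μ i) =
        -(t * ∑ i, p i * y i) := by
      rw [Finset.mul_sum, ← Finset.sum_neg_distrib]
      refine Finset.sum_congr rfl fun i _ => ?_
      split_ifs with hi
      · ring
      · rw [hp i (key2 i hi)]; ring
    rw [e] at h3
    by_contra! hc
    nlinarith
  · intro h L hL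
    obtain ⟨t, ht0, H⟩ := exists_small
      (fun i t => 0 < n i → t * (μ i * (L i - ν i / μ i)) ≤ n i) (fun i => by
        by_cases hi : 0 < n i
        · obtain ⟨ε, h0, h1⟩ := small_mul_le_aux hi (μ i * (L i - ν i / μ i))
          exact ⟨ε, h0, fun t a b _ => h1 t a b⟩
        · exact ⟨1, one_pos, fun t _ _ h => absurd h hi⟩)
    have H := H t ht0 le_rfl
    have hm : (fun i => n i + t * (μ i * (ν i / μ i - L i))) ∈
        WFeasible A C ν μ (wl A μ n) := by
      refine ⟨fun i => ?_, fun j hj => ?_⟩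
      · dsimp only
        by_cases hi : 0 < n i
        · linarith [H i hi]
        · rw [hL.2.1 i (key2 i hi), sub_zero]
          have := hn i; have := hρ i; have := hμ i
          positivity
      · have e : ∑ i, A j i * (n i + t * (μ i * (ν i / μ i - L i))) / μ i =
            wl A μ n j + t * (∑ i, A j i * (ν i / μ i) - ∑ i, A j i * L i) := by
          unfold wl
          rw [← Finset.sum_sub_distrib, Finset.mul_sum, ← Finset.sum_add_distrib]
          refine Finset.sum_congr rfl fun i _ => ?_
          have := (hμ i).ne'
          field_simp
        rw [e]
        have hj' : ∑ i, A j i * (ν i / μ i) = C j := hj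
        rw [hj']
        have := mul_nonneg ht0.le (sub_nonneg.mpr (hL.2.2 j))
        linarith
    have h3 := h _ hm
    have e : ∑ i, p i * ((n i + t * (μ i * (ν i / μ i - L i)) - n i) / μ i) =
        -(t * ∑ i, p i * (L i - ν i / μ i)) := by
      rw [Finset.mul_sum, ← Finset.sum_neg_distrib]
      refine Finset.sum_congr rfl fun i _ => ?_
      have := (hμ i).ne'
      field_simp
      ring
    rw [e] at h3
    by_contra! hc
    nlinarith

theorem fluid_iff {I J : ℕ}
    (A : Fin J → Fin I → ℝ) (C : Fin J → ℝ) (ν μ : Fin I → ℝ) (hμ : ∀ i, 0 < μ i)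
    (hload : ∀ j, (∑ i, A j i * (ν i / μ i)) ≤ C j)
    (Λ : (Fin I → ℝ) → Fin I → ℝ)
    (n : Fin I → ℝ) (hn : ∀ i, 0 ≤ n i) :
    (IsFluidSol A C ν μ Λ fun _ => n) ↔ ∀ i, 0 < n i → Λ n i = ν i / μ i := by
  constructor
  · intro h i hi
    have h1 := ((h.2.2 0 self_mem_Ici (fun i => differentiableWithinAt_const _)).1 i).1 hi
    have h2 : HasDerivWithinAt (fun _ : ℝ => n i) 0 (Ici 0) 0 := hasDerivWithinAt_const _ _ _
    have h3 := (uniqueDiffWithinAt_Ici (0:ℝ)).eq_deriv _ h1 h2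
    rw [eq_div_iff (hμ i).ne']
    linarith
  · intro h
    refine ⟨fun i T hT ε hε => ⟨1, one_pos, fun m a b _ _ _ => by simpa using hε⟩,
      fun t _ => hn, fun t _ _ => ⟨fun i => ⟨fun hi => ?_, fun _ => hasDerivWithinAt_const _ _ _⟩,
        fun j => ?_⟩⟩
    · have e : ν i - μ i * Λ n i = 0 := by
        rw [h i hi, mul_div_cancel₀ _ (hμ i).ne', sub_self]
      show HasDerivWithinAt (fun _ : ℝ => n i) (ν i - μ i * Λ n i) (Ici 0) t
      rw [e]; exact hasDerivWithinAt_const _ _ _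
    · refine le_trans (le_of_eq (Finset.sum_congr rfl fun i _ => ?_)) (hload j)
      split_ifs with hi
      · rw [h i hi]
      · rfl

theorem stmt8 {I J : ℕ} (hI : 0 < I) (hJ : 0 < J)
    (A : Fin J → Fin I → ℝ) (hA01 : ∀ j i, A j i = 0 ∨ A j i = 1)
    (hAcol : ∀ i, ∃ j, A j i = 1) (hArank : LinearIndependent ℝ A)
    (C : Fin J → ℝ) (hC : ∀ j, 0 < C j)
    (α : ℝ) (hα : 0 < α) (κ : Fin I → ℝ) (hκ : ∀ i, 0 < κ i)
    (ν μ : Fin I → ℝ) (hν : ∀ i, 0 < ν i) (hμ : ∀ i, 0 < μ i)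
    (hload : ∀ j, (∑ i, A j i * (ν i / μ i)) ≤ C j)
    (hJs : (Jstar A C ν μ).Nonempty)
    (Λ : (Fin I → ℝ) → Fin I → ℝ)
    (hΛ : ∀ n : Fin I → ℝ, (∀ i, 0 ≤ n i) → IsAlloc A C α κ n (Λ n))
    (Δ : (Fin J → ℝ) → Fin I → ℝ)
    (hΔ : ∀ w : Fin J → ℝ, (∀ j, 0 ≤ w j) →
      Δ w ∈ WFeasible A C ν μ w ∧
        ∀ m ∈ WFeasible A C ν μ w, Ffun α κ ν μ (Δ w) ≤ Ffun α κ ν μ m)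
    (n : Fin I → ℝ) (hn : ∀ i, 0 ≤ n i) :
    (IsFluidSol A C ν μ Λ fun _ => n) ↔ n = Δ (wl A μ n) := by
  have hρ : ∀ i, 0 < ν i / μ i := fun i => div_pos (hν i) (hμ i)
  have hw : ∀ j, 0 ≤ wl A μ n j := fun j => Finset.sum_nonneg fun i _ =>
    div_nonneg (mul_nonneg (by rcases hA01 j i with h | h <;> simp [h]) (hn i)) (hμ i).le
  rw [fluid_iff A C ν μ hμ hload Λ n hn,
    alloc_iff A hA01 C α hα κ hκ (fun i => ν i / μ i) hρ hload n hn (Λ n) (hΛ n hn),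
    delta_iff A C α hα κ hκ ν μ hν hμ n hn _ (hΔ _ hw)]
  exact foc_iff A hA01 C ν μ hν hμ hload n hn
    (fun i => κ i * n i ^ α * (ν i / μ i) ^ (-α)) (fun i hi => by
      simp [hi, Real.zero_rpow hα.ne'])
end
end
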